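/- Let 𝒯 = ({J_1,…,J_ℓ}, T) be a tree decomposition rooted at r, let C, A_1,…,A_m be n×n real symmetric matrices with splittings (C_j)_{j=1}^ℓ and (A_{i,j})_{j=1}^ℓ on 𝒯. Then the following are equivalent: (a) there exist y ∈ ℝ^m and a family (V_i)_{i ≠ r}, with V_i real symmetric indexed by (J_i ∩ J_{p(i)}) × (J_i ∩ J_{p(i)}), such that for every node j the matrix C_j − Σ_{i=1}^m y_i A_{i,j} − ι_j(V_j) + Σ_{c ∈ ch(j)} ι_j(V_c) is positive definite (the term ι_j(V_j) being absent when j = r); (b) there exists y ∈ ℝ^m such that C − Σ_{i=1}^m y_i A_i is positive definite. -/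

import Mathlib

open Matrix

/-- `(J, T)` is a tree decomposition of the graph `G`:  `T` is a tree, every vertex of `G`
is covered by some bag, every edge of `G` is covered by some bag, and the bags containing any
fixed vertex satisfy the running-intersection property along paths of `T`. -/
def IsTreeDecomp {n ℓ : ℕ} (G : SimpleGraph (Fin n)) (T : SimpleGraph (Fin ℓ))
    (J : Fin ℓ → Finset (Fin n)) : Prop :=
  T.IsTree ∧
  (∀ v : Fin n, ∃ k, v ∈ J k) ∧
  (∀ u v : Fin n, G.Adj u v → ∃ k, u ∈ J k ∧ v ∈ J k) ∧
  (∀ (i j : Fin ℓ) (w : T.Walk i j), w.IsPath →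
    ∀ v : Fin n, v ∈ J i → v ∈ J j → ∀ k ∈ w.support, v ∈ J k)

/-- The principal submatrix of `X` with rows and columns in `s`. -/
def psub {n : ℕ} (X : Matrix (Fin n) (Fin n) ℝ) (s : Finset (Fin n)) :
    Matrix s s ℝ :=
  X.submatrix Subtype.val Subtype.val

/-- `p` is the parent map of the tree `T` rooted at `r`:  the root is its own parent, every
non-root node is adjacent to its parent, the parent of a non-root node lies on the (unique)
path from the node to the root, and the edges of `T` are exactly the parent-child pairs. -/
def IsRootedAt {ℓ : ℕ} (T : SimpleGraph (Fin ℓ)) (r : Fin ℓ) (p : Fin ℓ → Fin ℓ) : Prop :=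
  p r = r ∧
  (∀ j, j ≠ r → T.Adj j (p j)) ∧
  (∀ j, j ≠ r → ∀ w : T.Walk j r, w.IsPath → p j ∈ w.support) ∧
  (∀ i j, T.Adj i j ↔ ((i ≠ r ∧ p i = j) ∨ (j ≠ r ∧ p j = i)))

/-- Entry `(u,v)` of the zero-padded embedding `ι` of the overlap-indexed symmetric matrix
`Y i` (indexed by `(J i ∩ J (p i)) × (J i ∩ J (p i))`): it agrees with `Y i` on the overlap
and vanishes elsewhere. -/
def padEntry {n ℓ : ℕ} (J : Fin ℓ → Finset (Fin n)) (p : Fin ℓ → Fin ℓ)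
    (Y : (i : Fin ℓ) → Matrix ↥(J i ∩ J (p i)) ↥(J i ∩ J (p i)) ℝ)
    (i : Fin ℓ) (u v : Fin n) : ℝ :=
  if h : u ∈ J i ∩ J (p i) ∧ v ∈ J i ∩ J (p i) then Y i ⟨u, h.1⟩ ⟨v, h.2⟩ else 0

/-- `(Ms j)_j` is a splitting of the symmetric matrix `M` on the tree decomposition with
bags `J`:  `Σ_j Ms j • X[J j, J j] = M • X` for every symmetric `X`, where `M • N = tr(Mᵀ N)`. -/
def IsSplitting {n ℓ : ℕ} (J : Fin ℓ → Finset (Fin n)) (M : Matrix (Fin n) (Fin n) ℝ)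
    (Ms : (j : Fin ℓ) → Matrix ↥(J j) ↥(J j) ℝ) : Prop :=
  ∀ X : Matrix (Fin n) (Fin n) ℝ, X.IsSymm →
    ∑ j : Fin ℓ, Matrix.trace ((Ms j)ᵀ * psub X (J j)) = Matrix.trace (Mᵀ * X)

/-- The quadratic form of a matrix. -/
def qf {ι : Type*} [Fintype ι] (M : Matrix ι ι ℝ) (x : ι → ℝ) : ℝ := x ⬝ᵥ (M *ᵥ x)

/-- `M` vanishes outside `S × S`. -/
def SuppOn {n : ℕ} (S : Finset (Fin n)) (M : Matrix (Fin n) (Fin n) ℝ) : Prop :=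
  ∀ u v, M u v ≠ 0 → u ∈ S ∧ v ∈ S

lemma qf_eq_sum {ι : Type*} [Fintype ι] (M : Matrix ι ι ℝ) (x : ι → ℝ) :
    qf M x = ∑ u, ∑ v, x u * M u v * x v := by
  simp [qf, dotProduct, mulVec, Finset.mul_sum, mul_assoc]

lemma qf_add {ι : Type*} [Fintype ι] (M N : Matrix ι ι ℝ) (x : ι → ℝ) :
    qf (M + N) x = qf M x + qf N x := by
  simp [qf, add_mulVec, dotProduct_add]

lemma qf_sub {ι : Type*} [Fintype ι] (M N : Matrix ι ι ℝ) (x : ι → ℝ) :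
    qf (M - N) x = qf M x - qf N x := by
  simp [qf, sub_mulVec, dotProduct_sub]

lemma qf_zero {ι : Type*} [Fintype ι] (x : ι → ℝ) :
    qf (0 : Matrix ι ι ℝ) x = 0 := by
  simp [qf]

lemma qf_smul {ι : Type*} [Fintype ι] (c : ℝ) (M : Matrix ι ι ℝ) (x : ι → ℝ) :
    qf (c • M) x = c * qf M x := by
  simp [qf, smul_mulVec, dotProduct_smul]

lemma qf_sum {ι κ : Type*} [Fintype ι] (s : Finset κ) (M : κ → Matrix ι ι ℝ) (x : ι → ℝ) :
    qf (∑ k ∈ s, M k) x = ∑ k ∈ s, qf (M k) x := by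
  classical
  induction s using Finset.induction_on with
  | empty => simp [qf_zero]
  | insert a s ha ih => rw [Finset.sum_insert ha, Finset.sum_insert ha, qf_add, ih]

lemma qf_congr {n : ℕ} {S : Finset (Fin n)} {M : Matrix (Fin n) (Fin n) ℝ} (hM : SuppOn S M)
    {x y : Fin n → ℝ} (h : ∀ i ∈ S, x i = y i) : qf M x = qf M y := by
  rw [qf_eq_sum, qf_eq_sum]
  refine Finset.sum_congr rfl fun u _ => Finset.sum_congr rfl fun v _ => ?_
  by_cases h0 : M u v = 0
  · simp [h0]
  · obtain ⟨hu, hv⟩ := hM u v h0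
    rw [h u hu, h v hv]

lemma qf_add_vec {ι : Type*} [Fintype ι] {M : Matrix ι ι ℝ} (hM : M.IsSymm) (x y : ι → ℝ)
    (h : y ⬝ᵥ (M *ᵥ x) = 0) : qf M (x + y) = qf M x + qf M y := by
  have h2 : x ⬝ᵥ (M *ᵥ y) = 0 := by
    rw [dotProduct_mulVec, ← mulVec_transpose, hM.eq, dotProduct_comm, h]
  simp [qf, mulVec_add, h, h2]

/-- Restriction of a vector, zero outside `S`. -/
def rs {n : ℕ} (S : Finset (Fin n)) : Matrix (Fin n) (Fin n) ℝ :=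
  diagonal fun i => if i ∈ S then 1 else 0

lemma rs_mulVec {n : ℕ} (S : Finset (Fin n)) (x : Fin n → ℝ) (i : Fin n) :
    (rs S *ᵥ x) i = if i ∈ S then x i else 0 := by
  simp [rs, mulVec_diagonal]

lemma rs_symm {n : ℕ} (S : Finset (Fin n)) : (rs S)ᵀ = rs S := by simp [rs]

lemma rs_mul_rs {n : ℕ} (S : Finset (Fin n)) : rs S * rs S = rs S := by
  simp [rs]

lemma qf_rs {n : ℕ} (S : Finset (Fin n)) (x : Fin n → ℝ) :
    qf (rs S) x = (rs S *ᵥ x) ⬝ᵥ (rs S *ᵥ x) := by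
  unfold qf
  simp only [dotProduct, rs_mulVec]
  refine Finset.sum_congr rfl fun i _ => ?_
  split_ifs <;> simp

lemma dot_self_nonneg' {n : ℕ} (x : Fin n → ℝ) : 0 ≤ x ⬝ᵥ x :=
  Finset.sum_nonneg fun _ _ => mul_self_nonneg _

lemma dot_self_pos' {n : ℕ} {x : Fin n → ℝ} (h : x ≠ 0) : 0 < x ⬝ᵥ x := by
  refine lt_of_le_of_ne (dot_self_nonneg' x) fun h0 => h ?_
  exact dotProduct_self_eq_zero.1 h0.symm

lemma dot_self_le {n : ℕ} {x y : Fin n → ℝ} (h : ∀ i, x i ≠ 0 → x i = y i) :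
    x ⬝ᵥ x ≤ y ⬝ᵥ y := by
  refine Finset.sum_le_sum fun i _ => ?_
  by_cases h0 : x i = 0
  · rw [h0]; simpa using mul_self_nonneg _
  · rw [h i h0]

lemma qf_conj {n : ℕ} (q B : Matrix (Fin n) (Fin n) ℝ) (x : Fin n → ℝ) :
    qf (Bᵀ * q * B) x = qf q (B *ᵥ x) := by
  unfold qf
  rw [← mulVec_mulVec, ← mulVec_mulVec, dotProduct_mulVec, vecMul_transpose]

/-- Existence of the minimizing map. -/
lemma exists_min_map {n : ℕ} (q : Matrix (Fin n) (Fin n) ℝ) (hq : q.IsSymm) (R : Finset (Fin n))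
    (hR : ∀ x : Fin n → ℝ, (∀ i, x i ≠ 0 → i ∈ R) → x ≠ 0 → 0 < qf q x) :
    ∃ F : Matrix (Fin n) (Fin n) ℝ, rs R * F = F ∧ rs R * q * (1 + F) = 0 := by
  set A : Matrix (Fin n) (Fin n) ℝ := rs R * q * rs R + (1 - rs R) with hA
  have hpd : A.PosDef := by
    refine PosDef.of_dotProduct_mulVec_pos ?_ fun x hx => ?_
    · have : Aᵀ = A := by
        simp [hA, transpose_mul, rs_symm, hq.eq, mul_assoc]
      rw [IsHermitian, conjTranspose_eq_transpose_of_trivial, this]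
    · have h1 : star x ⬝ᵥ (A *ᵥ x) = qf A x := by simp [qf]
      have h2 : qf A x = qf q (rs R *ᵥ x) + (x ⬝ᵥ x - qf (rs R) x) := by
        rw [hA, qf_add, qf_sub]
        congr 1
        · have := qf_conj q (rs R) x
          rwa [rs_symm] at this
        · simp [qf]
      rw [h1, h2]
      have h4 : qf (rs R) x ≤ x ⬝ᵥ x := by
        rw [qf_rs]
        refine dot_self_le fun i => ?_
        rw [rs_mulVec]; split_ifs <;> simp
      by_cases h0 : rs R *ᵥ x = 0
      · have h3 := dot_self_pos' hx
        rw [qf_rs, h0]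
        simpa [qf] using h3
      · have := hR (rs R *ᵥ x) (fun i hi => by
          rw [rs_mulVec] at hi; by_contra h; simp [h] at hi) h0
        linarith
  have hu := hpd.isUnit
  have hAP : A * A⁻¹ = 1 := mul_nonsing_inv _ ((isUnit_iff_isUnit_det _).1 hu)
  have hRAP : rs R * q * rs R * A⁻¹ = rs R := by
    have h1 : rs R * A = rs R * q * rs R := by
      rw [hA, mul_add, mul_sub, rs_mul_rs, mul_one, sub_self, add_zero, ← mul_assoc, ← mul_assoc,
        rs_mul_rs]
    rw [← h1, mul_assoc, hAP, mul_one]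
  refine ⟨-(rs R * A⁻¹ * q), ?_, ?_⟩
  · rw [mul_neg, ← mul_assoc, ← mul_assoc, rs_mul_rs]
  · rw [mul_add, mul_neg, mul_one, ← mul_assoc, ← mul_assoc, hRAP, add_neg_cancel]

lemma core {n : ℕ} (q : Matrix (Fin n) (Fin n) ℝ) (h : (Fin n → ℝ) → ℝ)
    (J U S : Finset (Fin n)) (hq : q.IsSymm) (hqs : SuppOn J q)
    (hh : ∀ x y : Fin n → ℝ, (∀ i ∈ U, x i = y i) → h x = h y)
    (hSJ : S ⊆ J) (hSU : S ⊆ U) (hJU : ∀ v ∈ J, v ∈ U → v ∈ S) (δ : ℝ) (hδ : 0 < δ)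
    (H : ∀ x : Fin n → ℝ, (∀ i, x i ≠ 0 → i ∈ J ∨ i ∈ U) → δ * (x ⬝ᵥ x) ≤ qf q x + h x)
    (hh0 : h 0 = 0) :
    ∃ W : Matrix (Fin n) (Fin n) ℝ, W.IsSymm ∧ SuppOn S W ∧
      (∀ x : Fin n → ℝ, (∀ i, x i ≠ 0 → i ∈ J) → x ≠ 0 → 0 < qf q x - qf W x) ∧
      (∀ x : Fin n → ℝ, (∀ i, x i ≠ 0 → i ∈ U) → δ / 2 * (x ⬝ᵥ x) ≤ h x + qf W x) := by
  have hRU : ∀ i ∈ J \ S, i ∉ U := fun i hi hU => by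
    rw [Finset.mem_sdiff] at hi; exact hi.2 (hJU i hi.1 hU)
  have hR : ∀ x : Fin n → ℝ, (∀ i, x i ≠ 0 → i ∈ J \ S) → x ≠ 0 → 0 < qf q x := by
    intro x hx hx0
    have h1 := H x fun i hi => Or.inl (Finset.mem_sdiff.1 (hx i hi)).1
    have h2 : h x = 0 := by
      rw [← hh0]; refine hh _ _ fun i hi => ?_
      by_contra h3; exact hRU i (hx i h3) hi
    have := mul_pos hδ (dot_self_pos' hx0)
    linarith
  obtain ⟨F, hF1, hF2⟩ := exists_min_map q hq (J \ S) hR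
  set R := J \ S with hRdef
  have hFR : ∀ s : Fin n → ℝ, ∀ i, i ∉ R → (F *ᵥ s) i = 0 := by
    intro s i hi
    rw [← hF1, ← mulVec_mulVec, rs_mulVec, if_neg hi]
  set B : Matrix (Fin n) (Fin n) ℝ := (1 + F) * rs S with hB
  have hBx : ∀ x, B *ᵥ x = rs S *ᵥ x + F *ᵥ (rs S *ᵥ x) := by
    intro x; rw [hB, ← mulVec_mulVec, add_mulVec, one_mulVec]
  set W : Matrix (Fin n) (Fin n) ℝ := Bᵀ * q * B - (δ / 2) • rs S with hW
  have hqW : ∀ x, qf W x = qf q (B *ᵥ x) - δ / 2 * ((rs S *ᵥ x) ⬝ᵥ (rs S *ᵥ x)) := by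
    intro x; rw [hW, qf_sub, qf_smul, qf_conj, qf_rs]
  have horth : ∀ x t : Fin n → ℝ, (∀ i, t i ≠ 0 → i ∈ R) → t ⬝ᵥ (q *ᵥ (B *ᵥ x)) = 0 := by
    intro x t ht
    have h1 : t = rs R *ᵥ t := by
      ext i; rw [rs_mulVec]; split_ifs with hi
      · rfl
      · by_contra h; exact hi (ht i h)
    have h2 : rs R *ᵥ (q *ᵥ (B *ᵥ x)) = 0 := by
      rw [hB, mulVec_mulVec, mulVec_mulVec, ← mul_assoc, hF2]; simp
    rw [h1, ← vecMul_transpose, rs_symm, ← dotProduct_mulVec, h2, dotProduct_zero]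
  refine ⟨W, ?_, ?_, ?_, ?_⟩
  · simp [IsSymm, hW, transpose_mul, rs_symm, hq.eq, mul_assoc]
  · have e1 : W = rs S * W * rs S := by
      have e2 : rs S * Bᵀ = Bᵀ := by
        rw [hB, transpose_mul, rs_symm, ← mul_assoc, rs_mul_rs]
      have e3 : B * rs S = B := by rw [hB, mul_assoc, rs_mul_rs]
      have e4 : rs S * (Bᵀ * q * B) * rs S = Bᵀ * q * B := by
        calc rs S * (Bᵀ * q * B) * rs S = (rs S * Bᵀ) * q * (B * rs S) := by
              simp only [mul_assoc]
          _ = _ := by rw [e2, e3]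
      rw [hW, mul_sub, sub_mul, e4]
      simp [rs_mul_rs]
    intro u v huv
    rw [e1] at huv
    simp only [rs, mul_diagonal, diagonal_mul] at huv
    constructor <;> by_contra hc <;> simp [hc] at huv
  · intro x hx hx0
    set s := rs S *ᵥ x with hs
    set t := x - B *ᵥ x with ht
    have htR : ∀ i, t i ≠ 0 → i ∈ R := by
      intro i hi
      by_contra hiR
      apply hi
      rw [ht, hBx]
      simp only [Pi.sub_apply, Pi.add_apply, hFR _ i hiR, rs_mulVec]
      split_ifs with hiS
      · simp
      · by_contra hxi
        apply hiR
        rw [hRdef, Finset.mem_sdiff]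
        exact ⟨hx i (by simpa using hxi), hiS⟩
    have e : qf q x = qf q (B *ᵥ x) + qf q t := by
      rw [← qf_add_vec hq _ _ (horth x t htR)]; congr 1; rw [ht]; abel
    rw [e, hqW]
    have hs0 := dot_self_nonneg' s
    by_cases ht0 : t = 0
    · have : s ≠ 0 := by
        intro h0
        apply hx0
        have : x = B *ᵥ x := by rw [ht] at ht0; exact sub_eq_zero.1 ht0
        rw [this, hBx, ← hs, h0]; simp
      have := mul_pos (half_pos hδ) (dot_self_pos' this)
      have h3 : qf q t = 0 := by rw [ht0]; simp [qf]
      linarith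
    · have := hR t htR ht0
      have := mul_nonneg (half_pos hδ).le hs0
      linarith
  · intro x hx
    set s := rs S *ᵥ x with hs
    set x' := x + F *ᵥ s with hx'
    have hxU : ∀ i ∈ U, x i = x' i := by
      intro i hi
      have : i ∉ R := fun h => hRU i h hi
      simp [hx', hFR s i this]
    have e1 : h x = h x' := hh _ _ hxU
    have e2 : qf q (B *ᵥ x) = qf q x' := by
      refine qf_congr hqs fun i hi => ?_
      rw [hBx, hx']
      simp only [Pi.add_apply, rs_mulVec]
      split_ifs with hiS
      · rfl
      · have : x i = 0 := by
          by_contra hc; exact hiS (hJU i hi (hx i hc))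
        rw [this]
    have e3 := H x' (by
      intro i hi
      by_contra hc
      push Not at hc
      apply hi
      have h1 : i ∉ R := fun h => hc.1 (Finset.mem_sdiff.1 h).1
      have h2 : x i = 0 := by by_contra h; exact hc.2 (hx i h)
      simp [hx', hFR s i h1, h2])
    have e4 : x ⬝ᵥ x ≤ x' ⬝ᵥ x' := dot_self_le fun i hi => hxU i (hx i hi)
    have e5 : s ⬝ᵥ s ≤ x ⬝ᵥ x := dot_self_le fun i => by
      rw [hs, rs_mulVec]; split_ifs <;> simp
    rw [hqW, e1, e2]
    have := mul_le_mul_of_nonneg_left e4 hδ.le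
    have := mul_le_mul_of_nonneg_left e5 (half_pos hδ).le
    linarith

lemma dist_parent_lt {ℓ : ℕ} {T : SimpleGraph (Fin ℓ)} (hT : T.IsTree) {r : Fin ℓ}
    {p : Fin ℓ → Fin ℓ} (hroot : IsRootedAt T r p) {j : Fin ℓ} (hj : j ≠ r) :
    T.dist (p j) r < T.dist j r := by
  obtain ⟨w, hw, hl⟩ := hT.connected.exists_path_of_dist j r
  have hmem := hroot.2.2.1 j hj w hw
  have hne : p j ≠ j := (hroot.2.1 j hj).ne'
  have h1 := SimpleGraph.Walk.length_dropUntil_lt_length hmem hne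
  have h2 := SimpleGraph.dist_le (w.dropUntil (p j) hmem)
  omega

lemma running {n ℓ : ℕ} {G : SimpleGraph (Fin n)} {T : SimpleGraph (Fin ℓ)}
    {J : Fin ℓ → Finset (Fin n)} (hTD : IsTreeDecomp G T J)
    {r : Fin ℓ} {p : Fin ℓ → Fin ℓ} (hroot : IsRootedAt T r p)
    (K : Finset (Fin ℓ)) (hK : ∀ k ∈ K, p k ∈ K) {j : Fin ℓ} (hj : j ≠ r)
    (hleaf : ∀ c ∈ K, c ≠ r → p c ≠ j) {k : Fin ℓ} (hk : k ∈ K) (hkj : k ≠ j)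
    {v : Fin n} (hvj : v ∈ J j) (hvk : v ∈ J k) : v ∈ J (p j) := by
  obtain ⟨w, hw, -⟩ := hTD.1.connected.exists_path_of_dist j k
  have hD : ¬ ∃ i : ℕ, p^[i] k = j := by
    rintro ⟨i, hi⟩
    have hiter : ∀ i, p^[i] k ∈ K := by
      intro i
      induction i with
      | zero => exact hk
      | succ i ih => rw [Function.iterate_succ_apply']; exact hK _ ih
    cases i with
    | zero => exact hkj hi
    | succ i =>
      rw [Function.iterate_succ_apply'] at hi
      refine hleaf _ (hiter i) ?_ hi
      intro h
      rw [h, hroot.1] at hi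
      exact hj hi.symm
  obtain ⟨d, hd, hd1, hd2⟩ := w.exists_boundary_dart {a | ∃ i : ℕ, p^[i] a = j} ⟨0, rfl⟩ hD
  have hsnd : d.snd = p j := by
    rcases (hroot.2.2.2 _ _).1 d.adj with ⟨h1, h2⟩ | ⟨h1, h2⟩
    · obtain ⟨i, hi⟩ := hd1
      cases i with
      | zero => rw [← h2]; congr 1
      | succ i =>
        exfalso
        apply hd2
        refine ⟨i, ?_⟩
        rw [← h2]; exact hi
    · exfalso
      obtain ⟨i, hi⟩ := hd1
      apply hd2
      refine ⟨i + 1, ?_⟩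
      rw [Function.iterate_succ_apply, h2, hi]
  have := w.dart_snd_mem_support_of_mem_darts hd
  rw [hsnd] at this
  exact hTD.2.2.2 j k w hw v hvj hvk _ this

lemma main_induction {n ℓ : ℕ} {G : SimpleGraph (Fin n)} {T : SimpleGraph (Fin ℓ)}
    {J : Fin ℓ → Finset (Fin n)} (hTD : IsTreeDecomp G T J)
    {r : Fin ℓ} {p : Fin ℓ → Fin ℓ} (hroot : IsRootedAt T r p) (N : ℕ) :
    ∀ (K : Finset (Fin ℓ)), K.card = N → r ∈ K → (∀ k ∈ K, p k ∈ K) →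
    ∀ (M : Fin ℓ → Matrix (Fin n) (Fin n) ℝ), (∀ k, (M k).IsSymm) → (∀ k, SuppOn (J k) (M k)) →
    ∀ δ : ℝ, 0 < δ →
    (∀ x : Fin n → ℝ, (∀ i, x i ≠ 0 → ∃ k ∈ K, i ∈ J k) →
      δ * (x ⬝ᵥ x) ≤ ∑ k ∈ K, qf (M k) x) →
    ∃ W : Fin ℓ → Matrix (Fin n) (Fin n) ℝ, (∀ k, (W k).IsSymm) ∧
      (∀ k, SuppOn (J k ∩ J (p k)) (W k)) ∧
      ∀ k ∈ K, ∀ x : Fin n → ℝ, (∀ i, x i ≠ 0 → i ∈ J k) → x ≠ 0 →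
        0 < qf (M k) x - (if k = r then 0 else qf (W k) x) +
          ∑ c ∈ K.filter (fun c => c ≠ r ∧ p c = k), qf (W c) x := by
  induction N with
  | zero =>
    intro K hc hr
    rw [Finset.card_eq_zero] at hc
    simp [hc] at hr
  | succ N ih =>
    intro K hc hr hK M hMs hMJ δ hδ H
    by_cases hE : (K.erase r).Nonempty
    · obtain ⟨j, hjE, hjmax⟩ := (K.erase r).exists_max_image (fun j => T.dist j r) hE
      obtain ⟨hjr, hjK⟩ := Finset.mem_erase.1 hjE
      have hleaf : ∀ c ∈ K, c ≠ r → p c ≠ j := by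
        intro c hcK hcr hpc
        have h1 := hjmax c (Finset.mem_erase.2 ⟨hcr, hcK⟩)
        have h2 := dist_parent_lt hTD.1 hroot hcr
        rw [hpc] at h2
        omega
      have hpj : p j ≠ j := (hroot.2.1 j hjr).ne'
      have hpjK : p j ∈ K.erase j := Finset.mem_erase.2 ⟨hpj, hK j hjK⟩
      obtain ⟨W0, hW0s, hW0S, hW0a, hW0b⟩ := core (M j) (fun x => ∑ k ∈ K.erase j, qf (M k) x)
        (J j) ((K.erase j).biUnion J) (J j ∩ J (p j)) (hMs j) (hMJ j)
        (fun x y hxy => Finset.sum_congr rfl fun k hk => qf_congr (hMJ k) fun i hi =>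
          hxy i (Finset.mem_biUnion.2 ⟨k, hk, hi⟩))
        Finset.inter_subset_left
        (fun i hi => Finset.mem_biUnion.2 ⟨p j, hpjK, (Finset.mem_inter.1 hi).2⟩)
        (fun v hv hvU => by
          obtain ⟨k, hk, hvk⟩ := Finset.mem_biUnion.1 hvU
          obtain ⟨hkj, hkK⟩ := Finset.mem_erase.1 hk
          exact Finset.mem_inter.2 ⟨hv, running hTD hroot K hK hjr hleaf hkK hkj hv hvk⟩)
        δ hδ
        (fun x hx => by
          rw [Finset.add_sum_erase K (fun k => qf (M k) x) hjK]
          refine H x fun i hi => ?_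
          rcases hx i hi with h | h
          · exact ⟨j, hjK, h⟩
          · obtain ⟨k, hk, hvk⟩ := Finset.mem_biUnion.1 h
            exact ⟨k, (Finset.mem_erase.1 hk).2, hvk⟩)
        (by simp [qf])
      have hM'q : ∀ k x, qf (M k + if k = p j then W0 else 0) x =
          qf (M k) x + if k = p j then qf W0 x else 0 := by
        intro k x; rw [qf_add]; split_ifs <;> simp [qf_zero]
      obtain ⟨W, hWs, hWS, hWpos⟩ := ih (K.erase j)
        (by rw [Finset.card_erase_of_mem hjK, hc]; rfl)
        (Finset.mem_erase.2 ⟨hjr.symm, hr⟩)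
        (fun k hk => by
          obtain ⟨hkj, hkK⟩ := Finset.mem_erase.1 hk
          refine Finset.mem_erase.2 ⟨?_, hK k hkK⟩
          by_cases hkr : k = r
          · rw [hkr, hroot.1]; exact hjr.symm
          · exact hleaf k hkK hkr)
        (fun k => M k + if k = p j then W0 else 0)
        (fun k => by
          split_ifs
          · exact (hMs k).add hW0s
          · simpa using hMs k)
        (fun k u v huv => by
          by_cases h0 : M k u v = 0
          · split_ifs at huv with hk
            · have := hW0S u v (by simpa [h0] using huv)
              rw [hk]
              exact ⟨(Finset.mem_inter.1 this.1).2, (Finset.mem_inter.1 this.2).2⟩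
            · simp [h0] at huv
          · exact hMJ k u v h0)
        (δ / 2) (half_pos hδ)
        (fun x hx => by
          have := hW0b x (fun i hi => Finset.mem_biUnion.2 (hx i hi))
          simp only [hM'q, Finset.sum_add_distrib]
          rw [Finset.sum_ite_eq', if_pos hpjK]
          exact this)
      refine ⟨Function.update W j W0, ?_, ?_, ?_⟩
      · intro k
        by_cases hk : k = j
        · subst hk; simpa using hW0s
        · simpa [hk] using hWs k
      · intro k
        by_cases hk : k = j
        · subst hk; simpa using hW0S
        · simpa [hk] using hWS k
      · intro k hk x hx hx0
        by_cases hkj : k = j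
        · subst hkj
          have he : K.filter (fun c => c ≠ r ∧ p c = k) = ∅ := by
            refine Finset.filter_eq_empty_iff.2 fun c hcK hcc => hleaf c hcK hcc.1 hcc.2
          rw [he]
          simpa [hjr] using hW0a x hx hx0
        · have h1 := hWpos k (Finset.mem_erase.2 ⟨hkj, hk⟩) x hx hx0
          rw [hM'q] at h1
          rw [Function.update_of_ne hkj]
          have h2 : ∑ c ∈ K.filter (fun c => c ≠ r ∧ p c = k), qf (Function.update W j W0 c) x
              = (if k = p j then qf W0 x else 0) +
                ∑ c ∈ (K.erase j).filter (fun c => c ≠ r ∧ p c = k), qf (W c) x := by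
            rw [Finset.sum_filter, Finset.sum_filter, ← Finset.add_sum_erase K _ hjK]
            congr 1
            · by_cases hkp : k = p j
              · simp [hkp, hjr]
              · simp [hkp, Ne.symm hkp]
            · refine Finset.sum_congr rfl fun c hcc => ?_
              rw [Function.update_of_ne (Finset.mem_erase.1 hcc).1]
          rw [h2]
          linarith
    · rw [Finset.not_nonempty_iff_eq_empty] at hE
      have hKr : K = {r} := by
        rw [← Finset.insert_erase hr, hE]; rfl
      subst hKr
      refine ⟨fun _ => 0, fun _ => by simp [IsSymm], fun _ u v h => by simp at h, ?_⟩
      intro k hk x hx hx0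
      have hkr := Finset.mem_singleton.1 hk
      subst hkr
      have h1 := H x fun i hi => ⟨k, hk, hx i hi⟩
      have := mul_pos hδ (dot_self_pos' hx0)
      simp only [Finset.sum_singleton] at h1
      simp [qf_zero]
      linarith

lemma exists_delta {n : ℕ} (Z : Matrix (Fin n) (Fin n) ℝ)
    (hZ : ∀ x : Fin n → ℝ, x ≠ 0 → 0 < qf Z x) :
    ∃ δ : ℝ, 0 < δ ∧ ∀ x : Fin n → ℝ, δ * (x ⬝ᵥ x) ≤ qf Z x := by
  by_cases hS : (Metric.sphere (0 : Fin n → ℝ) 1).Nonempty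
  · have hne : ∀ x ∈ Metric.sphere (0 : Fin n → ℝ) 1, x ≠ 0 := by
      rintro x hx rfl; simp at hx
    have hcont : ContinuousOn (fun x : Fin n → ℝ => qf Z x / (x ⬝ᵥ x))
        (Metric.sphere (0 : Fin n → ℝ) 1) := by
      refine ContinuousOn.div ?_ ?_ fun x hx => (dot_self_pos' (hne x hx)).ne'
      · unfold qf dotProduct mulVec dotProduct
        fun_prop
      · unfold dotProduct
        fun_prop
    obtain ⟨x0, hx0, hmin⟩ := (isCompact_sphere (0 : Fin n → ℝ) 1).exists_isMinOn hS hcont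
    refine ⟨qf Z x0 / (x0 ⬝ᵥ x0), div_pos (hZ _ (hne _ hx0)) (dot_self_pos' (hne _ hx0)), ?_⟩
    intro x
    by_cases hx : x = 0
    · subst hx; simp [qf]
    · have hnx : ‖x‖ ≠ 0 := norm_ne_zero_iff.2 hx
      have h1 := hmin (show ‖x‖⁻¹ • x ∈ Metric.sphere (0 : Fin n → ℝ) 1 by
        simp [norm_smul, hnx])
      have h2 : qf Z (‖x‖⁻¹ • x) / ((‖x‖⁻¹ • x) ⬝ᵥ (‖x‖⁻¹ • x)) = qf Z x / (x ⬝ᵥ x) := by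
        have := (dot_self_pos' hx).ne'
        simp only [qf, mulVec_smul, dotProduct_smul, smul_dotProduct, smul_eq_mul]
        field_simp
      simp only [Set.mem_ofPred_eq, h2] at h1
      rwa [le_div_iff₀ (dot_self_pos' hx)] at h1
  · refine ⟨1, one_pos, fun x => ?_⟩
    by_cases hx : x = 0
    · subst hx; simp [qf]
    · exact absurd ⟨‖x‖⁻¹ • x, by simp [norm_smul, norm_ne_zero_iff.2 hx]⟩ hS

/-- Zero padding. -/
def padM {n : ℕ} (s : Finset (Fin n)) (M : Matrix s s ℝ) : Matrix (Fin n) (Fin n) ℝ :=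
  Matrix.of fun u v => if h : u ∈ s ∧ v ∈ s then M ⟨u, h.1⟩ ⟨v, h.2⟩ else 0

lemma padM_supp {n : ℕ} (s : Finset (Fin n)) (M : Matrix s s ℝ) : SuppOn s (padM s M) := by
  intro u v h
  by_contra hc
  exact h (by simp only [padM, of_apply]; rw [dif_neg hc])

lemma padM_symm {n : ℕ} (s : Finset (Fin n)) (M : Matrix s s ℝ) (hM : M.IsSymm) :
    (padM s M).IsSymm := by
  ext u v
  simp only [padM, transpose_apply, of_apply]
  by_cases h : u ∈ s ∧ v ∈ s
  · rw [dif_pos h, dif_pos h.symm]; exact hM.apply _ _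
  · rw [dif_neg h, dif_neg fun h' => h h'.symm]

lemma padM_apply {n : ℕ} (s : Finset (Fin n)) (M : Matrix s s ℝ) (a b : s) :
    padM s M a.1 b.1 = M a b := by
  simp [padM]

lemma qf_psub {n : ℕ} (s : Finset (Fin n)) (N : Matrix (Fin n) (Fin n) ℝ) (hN : SuppOn s N)
    (x : Fin n → ℝ) : qf (psub N s) (fun a => x a.1) = qf N x := by
  rw [qf_eq_sum, qf_eq_sum]
  have h1 : ∀ f : Fin n → ℝ, (∀ u, u ∉ s → f u = 0) → ∑ a : s, f a.1 = ∑ u, f u := by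
    intro f hf
    rw [Finset.sum_coe_sort s f]
    exact Finset.sum_subset (Finset.subset_univ _) fun u _ hu => hf u hu
  have h0 : ∀ u v, ¬ (u ∈ s ∧ v ∈ s) → N u v = 0 := fun u v h => by
    by_contra hc; exact h (hN u v hc)
  rw [← h1 (fun u => ∑ v, x u * N u v * x v)]
  · refine Finset.sum_congr rfl fun a _ => ?_
    rw [← h1 (fun v => x a * N a v * x v)]
    · rfl
    · intro v hv; rw [h0 _ _ fun h => hv h.2]; ring
  · intro u hu
    refine Finset.sum_eq_zero fun v _ => ?_
    rw [h0 _ _ fun h => hu h.1]; ring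

lemma posDef_iff_qf {ι : Type*} [Fintype ι] (M : Matrix ι ι ℝ) :
    M.PosDef ↔ M.IsSymm ∧ ∀ x : ι → ℝ, x ≠ 0 → 0 < qf M x := by
  rw [posDef_iff_dotProduct_mulVec, IsHermitian, conjTranspose_eq_transpose_of_trivial]
  simp [qf, IsSymm]

lemma posDef_psub {n : ℕ} (s : Finset (Fin n)) (N : Matrix (Fin n) (Fin n) ℝ) (hN : SuppOn s N)
    (hs : N.IsSymm) : (psub N s).PosDef ↔
      ∀ x : Fin n → ℝ, (∀ i, x i ≠ 0 → i ∈ s) → x ≠ 0 → 0 < qf N x := by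
  rw [posDef_iff_qf]
  constructor
  · rintro ⟨-, h⟩ x hx hx0
    rw [← qf_psub s N hN x]
    refine h _ fun h0 => hx0 ?_
    ext i
    by_contra hc
    exact hc (congrFun h0 ⟨i, hx i hc⟩)
  · intro h
    refine ⟨hs.submatrix _, fun y hy => ?_⟩
    set x : Fin n → ℝ := fun i => if h : i ∈ s then y ⟨i, h⟩ else 0 with hx
    have hxy : (fun a : s => x a.1) = y := by ext a; simp [hx]
    rw [← hxy, qf_psub s N hN]
    refine h x (fun i hi => ?_) fun h0 => hy ?_
    · by_contra hc; simp [hx, hc] at hi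
    · rw [← hxy, h0]; rfl

lemma qf_splitting {n ℓ : ℕ} {J : Fin ℓ → Finset (Fin n)} {M : Matrix (Fin n) (Fin n) ℝ}
    {Ms : (j : Fin ℓ) → Matrix ↥(J j) ↥(J j) ℝ} (h : IsSplitting J M Ms) (x : Fin n → ℝ) :
    ∑ j, qf (padM (J j) (Ms j)) x = qf M x := by
  have key : ∀ {ι : Type} [Fintype ι] (N : Matrix ι ι ℝ) (z : ι → ℝ),
      trace (Nᵀ * vecMulVec z z) = qf N z := by
    intro ι _ N z
    rw [qf_eq_sum, trace, Finset.sum_comm]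
    simp only [diag_apply, mul_apply, transpose_apply, vecMulVec_apply]
    refine Finset.sum_congr rfl fun u _ => Finset.sum_congr rfl fun v _ => ?_
    ring
  have h1 := h (vecMulVec x x) (by ext a b; simp [vecMulVec_apply, mul_comm])
  rw [key] at h1
  rw [← h1]
  refine Finset.sum_congr rfl fun j _ => ?_
  have h2 : psub (vecMulVec x x) (J j) = vecMulVec (fun a : J j => x a.1) (fun a => x a.1) := rfl
  rw [h2, key, ← qf_psub (J j) _ (padM_supp _ _)]
  congr 1
  ext a b
  simp [psub, padM_apply]

/-- dual Slater condition transfers:  there exist `y` and an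
overlap-indexed symmetric family `(V i)_{i ≠ r}` such that
`C j − Σ_i y i • As i j − ι_j (V j) + Σ_{c ∈ ch(j)} ι_j (V c)` is positive definite for
every node `j` (the `ι_j (V j)` term absent at the root), iff there exists `y` with
`C − Σ_i y i • A i` positive definite. -/
theorem dual_slater_transfer {n ℓ m : ℕ}
    (G : SimpleGraph (Fin n)) (T : SimpleGraph (Fin ℓ))
    (J : Fin ℓ → Finset (Fin n)) (hTD : IsTreeDecomp G T J)
    (r : Fin ℓ) (p : Fin ℓ → Fin ℓ) (hroot : IsRootedAt T r p)
    (C : Matrix (Fin n) (Fin n) ℝ) (hCsymm : C.IsSymm)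
    (hCsparse : ∀ a c : Fin n, C a c ≠ 0 → a = c ∨ G.Adj a c)
    (Cs : (j : Fin ℓ) → Matrix ↥(J j) ↥(J j) ℝ) (hCssymm : ∀ j, (Cs j).IsSymm)
    (hCsplit : IsSplitting J C Cs)
    (A : Fin m → Matrix (Fin n) (Fin n) ℝ) (hAsymm : ∀ i, (A i).IsSymm)
    (hsparse : ∀ (i : Fin m) (a c : Fin n), A i a c ≠ 0 → a = c ∨ G.Adj a c)
    (As : (i : Fin m) → (j : Fin ℓ) → Matrix ↥(J j) ↥(J j) ℝ)
    (hAssymm : ∀ i j, (As i j).IsSymm)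
    (hsplit : ∀ i, IsSplitting J (A i) (As i)) :
    (∃ (y : Fin m → ℝ)
        (V : (i : Fin ℓ) → Matrix ↥(J i ∩ J (p i)) ↥(J i ∩ J (p i)) ℝ),
        (∀ i, i ≠ r → (V i).IsSymm) ∧
        ∀ j : Fin ℓ,
          (Matrix.of fun a b : ↥(J j) =>
            Cs j a b - (∑ i : Fin m, y i * As i j a b) -
              (if j = r then 0 else padEntry J p V j a.1 b.1) +
              ∑ c ∈ Finset.univ.filter (fun c => c ≠ r ∧ p c = j),
                padEntry J p V c a.1 b.1).PosDef) ↔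
      (∃ y : Fin m → ℝ, (C - ∑ i : Fin m, y i • A i).PosDef) := by
  classical
  let D : (Fin m → ℝ) → Fin ℓ → Matrix (Fin n) (Fin n) ℝ := fun y j =>
    padM (J j) (Cs j) - ∑ i, y i • padM (J j) (As i j)
  let NN : (Fin m → ℝ) → ((i : Fin ℓ) → Matrix ↥(J i ∩ J (p i)) ↥(J i ∩ J (p i)) ℝ) →
      Fin ℓ → Matrix (Fin n) (Fin n) ℝ := fun y V j =>
    D y j - (if j = r then 0 else padM _ (V j)) +
      ∑ c ∈ Finset.univ.filter (fun c => c ≠ r ∧ p c = j), padM _ (V c)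
  have hDq : ∀ y x, ∑ j, qf (D y j) x = qf (C - ∑ i, y i • A i) x := by
    intro y x
    simp only [D, qf_sub, qf_sum, qf_smul, Finset.sum_sub_distrib]
    rw [qf_splitting hCsplit, Finset.sum_comm]
    congr 1
    refine Finset.sum_congr rfl fun i _ => ?_
    rw [← Finset.mul_sum, qf_splitting (hsplit i)]
  have hDsymm : ∀ y j, (D y j).IsSymm := by
    intro y j
    have h1 : ∀ i, (padM (J j) (As i j))ᵀ = padM (J j) (As i j) :=
      fun i => (padM_symm _ _ (hAssymm i j)).eq
    simp [D, IsSymm, transpose_sum, h1, (padM_symm _ _ (hCssymm j)).eq]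
  have hDsupp : ∀ y j, SuppOn (J j) (D y j) := by
    intro y j u v huv
    by_contra hc
    apply huv
    have hz : ∀ M, padM (J j) M u v = 0 := fun M => by
      by_contra h; exact hc (padM_supp _ _ u v h)
    simp only [D, Matrix.sub_apply, Matrix.sum_apply, Matrix.smul_apply, hz]
    simp
  have hNsymm : ∀ y V, (∀ i, i ≠ r → (V i).IsSymm) → ∀ j, (NN y V j).IsSymm := by
    intro y V hV j
    refine ((hDsymm y j).sub ?_).add ?_
    · split_ifs with h
      · simp [IsSymm]
      · exact padM_symm _ _ (hV j h)
    · rw [IsSymm, transpose_sum]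
      refine Finset.sum_congr rfl fun c hc => ?_
      exact (padM_symm _ _ (hV c (Finset.mem_filter.1 hc).2.1)).eq
  have hNsupp : ∀ y V j, SuppOn (J j) (NN y V j) := by
    intro y V j u v huv
    by_contra hc
    apply huv
    have h1 : D y j u v = 0 := by by_contra h; exact hc (hDsupp y j u v h)
    have h2 : (if j = r then 0 else padM _ (V j)) u v = 0 := by
      by_contra h
      apply hc
      split_ifs at h with hj
      · simp at h
      · have := padM_supp _ _ u v h
        exact ⟨(Finset.mem_inter.1 this.1).1, (Finset.mem_inter.1 this.2).1⟩
    have h3 : ∀ c ∈ Finset.univ.filter (fun c => c ≠ r ∧ p c = j), padM _ (V c) u v = 0 := by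
      intro c hcc
      by_contra h
      apply hc
      have := padM_supp _ _ u v h
      rw [← (Finset.mem_filter.1 hcc).2.2]
      exact ⟨(Finset.mem_inter.1 this.1).2, (Finset.mem_inter.1 this.2).2⟩
    simp only [NN, Matrix.add_apply, Matrix.sub_apply, Matrix.sum_apply, h1, h2]
    rw [Finset.sum_eq_zero h3]; simp
  have hNq : ∀ y V j x, qf (NN y V j) x = qf (D y j) x -
      (if j = r then 0 else qf (padM _ (V j)) x) +
      ∑ c ∈ Finset.univ.filter (fun c => c ≠ r ∧ p c = j), qf (padM _ (V c)) x := by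
    intro y V j x
    simp only [NN, qf_add, qf_sub, qf_sum]
    split_ifs <;> simp [qf_zero]
  have hmat : ∀ y V j, (Matrix.of fun a b : ↥(J j) =>
            Cs j a b - (∑ i : Fin m, y i * As i j a b) -
              (if j = r then 0 else padEntry J p V j a.1 b.1) +
              ∑ c ∈ Finset.univ.filter (fun c => c ≠ r ∧ p c = j),
                padEntry J p V c a.1 b.1) = psub (NN y V j) (J j) := by
    intro y V j
    have hpad : ∀ c u v, padEntry J p V c u v = padM _ (V c) u v := fun _ _ _ => rfl
    ext a b
    simp only [psub, submatrix_apply, NN, D, of_apply, Matrix.add_apply, Matrix.sub_apply, Matrix.sum_apply,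
      Matrix.smul_apply, padM_apply, smul_eq_mul, hpad]
    split_ifs <;> rfl
  simp only [hmat]
  clear_value NN D
  constructor
  · rintro ⟨y, V, hV, hpos⟩
    refine ⟨y, (posDef_iff_qf _).2 ⟨?_, fun x hx => ?_⟩⟩
    · have h1 : ∀ i, (A i)ᵀ = A i := fun i => (hAsymm i).eq
      simp [IsSymm, transpose_sum, h1, hCsymm.eq]
    · have hsum : ∑ j, qf (NN y V j) x = qf (C - ∑ i, y i • A i) x := by
        simp only [hNq, Finset.sum_add_distrib, Finset.sum_sub_distrib, hDq]
        have h1 : ∑ j, ∑ c ∈ Finset.univ.filter (fun c => c ≠ r ∧ p c = j), qf (padM _ (V c)) x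
            = ∑ j, if j = r then 0 else qf (padM _ (V j)) x := by
          simp only [Finset.sum_filter]
          rw [Finset.sum_comm]
          refine Finset.sum_congr rfl fun c _ => ?_
          by_cases hcr : c = r <;> simp [hcr]
        rw [h1]; ring
      rw [← hsum]
      have hloc : ∀ j, (rs (J j) *ᵥ x ≠ 0 → 0 < qf (NN y V j) x) ∧ 0 ≤ qf (NN y V j) x := by
        intro j
        have e : qf (NN y V j) x = qf (NN y V j) (rs (J j) *ᵥ x) :=
          qf_congr (hNsupp y V j) fun i hi => by rw [rs_mulVec, if_pos hi]
        have hp : rs (J j) *ᵥ x ≠ 0 → 0 < qf (NN y V j) x := by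
          intro h
          rw [e]
          refine (posDef_psub _ _ (hNsupp y V j) (hNsymm y V hV j)).1 (hpos j) _ ?_ h
          intro i hi
          by_contra hc
          rw [rs_mulVec, if_neg hc] at hi
          exact hi rfl
        refine ⟨hp, ?_⟩
        by_cases h : rs (J j) *ᵥ x = 0
        · rw [e, h]; simp [qf]
        · exact (hp h).le
      obtain ⟨v, hv⟩ := Function.ne_iff.1 hx
      obtain ⟨k, hk⟩ := hTD.2.1 v
      refine Finset.sum_pos' (fun j _ => (hloc j).2) ⟨k, Finset.mem_univ _, (hloc k).1 ?_⟩
      intro h0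
      have := congrFun h0 v
      rw [rs_mulVec, if_pos hk] at this
      exact hv this
  · rintro ⟨y, hy⟩
    obtain ⟨δ, hδ, hd⟩ := exists_delta _ ((posDef_iff_qf _).1 hy).2
    obtain ⟨W, hWs, hWS, hW⟩ := main_induction hTD hroot _ Finset.univ rfl (Finset.mem_univ _)
      (fun _ _ => Finset.mem_univ _) (D y) (hDsymm y) (hDsupp y) δ hδ
      (fun x _ => (hd x).trans (hDq y x).ge)
    obtain ⟨V, hV, hpw⟩ : ∃ V : (i : Fin ℓ) → Matrix ↥(J i ∩ J (p i)) ↥(J i ∩ J (p i)) ℝ,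
        (∀ i, i ≠ r → (V i).IsSymm) ∧ ∀ i, padM _ (V i) = W i := by
      refine ⟨fun i => psub (W i) _, fun i _ => (hWs i).submatrix _, fun i => ?_⟩
      ext u v
      simp only [padM, psub, of_apply, submatrix_apply]
      split_ifs with h
      · rfl
      · by_contra hc
        exact h (hWS i u v (Ne.symm hc))
    refine ⟨y, V, hV, fun j => ?_⟩
    refine (posDef_psub _ _ (hNsupp y V j) (hNsymm y V hV j)).2 fun x hx hx0 => ?_
    rw [hNq]
    simp only [hpw]
    exact hW j (Finset.mem_univ _) x hx hx0
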